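/- arXiv:0806.1275 — 2 statements merged into one kernel-verified Lean document; each statement's English description precedes it below -/
import Mathlib

section
/- Let r, a > 0, let D = {z ∈ ℂ : 0 < Im z < r}, and let u : D → [0, a) be a bounded subharmonic function such that u(z) → 0 as z → x within D, for every real boundary point x ∈ ℝ. If either there exists z₀ ∈ D with u(z₀) = (a/r)·Im z₀, or there exists x₀ ∈ ℝ with limsup_{y→0⁺} u(x₀+iy)/y = a/r, then u(z) = (a/r)·Im z for every z ∈ D. -/
open Metric Filter Complex Set

/-- A function `u : ℂ → ℝ` is *subharmonic* on an open set `D ⊆ ℂ` if it is upper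
semicontinuous on `D` and satisfies the sub-mean-value inequality on every closed
disc contained in `D`. -/
def SubharmonicOn (u : ℂ → ℝ) (D : Set ℂ) : Prop :=
  UpperSemicontinuousOn u D ∧
    ∀ c : ℂ, ∀ r : ℝ, 0 < r → closedBall c r ⊆ D →
      u c ≤ (2 * Real.pi)⁻¹ * ∫ θ in (0:ℝ)..(2 * Real.pi), u (circleMap c r θ)

theorem aux_circle (g : ℝ → ℝ) (M : ℝ) (hper : Function.Periodic g (2 * Real.pi))
    (husc : UpperSemicontinuous g)
    (hint : ∀ a b, IntervalIntegrable g MeasureTheory.volume a b)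
    (hle : ∀ t, g t ≤ M)
    (hM : M ≤ (2 * Real.pi)⁻¹ * ∫ t in (0:ℝ)..(2 * Real.pi), g t) (t₀ : ℝ) : g t₀ = M := by
  by_contra hne
  have hlt : g t₀ < M := lt_of_le_of_ne (hle t₀) hne
  have hpi := Real.pi_pos
  have h1 := hper.intervalIntegral_add_eq 0 (t₀ - Real.pi)
  rw [zero_add] at h1
  rw [h1] at hM
  have hab : t₀ - Real.pi ≤ t₀ - Real.pi + 2 * Real.pi := by linarith
  have h2 : ∫ t in (t₀ - Real.pi)..(t₀ - Real.pi + 2 * Real.pi), g t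
      < ∫ t in (t₀ - Real.pi)..(t₀ - Real.pi + 2 * Real.pi), M := by
    apply intervalIntegral.integral_lt_integral_of_ae_le_of_measure_setOfPred_lt_ne_zero hab
      (hint _ _) intervalIntegrable_const (Eventually.of_forall hle)
    have hopen : IsOpen {t | g t < M} := husc.isOpen_preimage M
    have hpos : 0 < MeasureTheory.volume
        ({t | g t < M} ∩ Ioo (t₀ - Real.pi) (t₀ - Real.pi + 2 * Real.pi)) := by
      exact (hopen.inter isOpen_Ioo).measure_pos MeasureTheory.volume
        ⟨t₀, hlt, by constructor <;> linarith⟩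
    rw [MeasureTheory.Measure.restrict_apply hopen.measurableSet]
    refine (lt_of_lt_of_le hpos (MeasureTheory.measure_mono ?_)).ne'
    exact inter_subset_inter_right _ Ioo_subset_Ioc_self
  rw [intervalIntegral.integral_const] at h2
  have h3 : (2 * Real.pi)⁻¹ * ∫ t in (t₀ - Real.pi)..(t₀ - Real.pi + 2 * Real.pi), g t < M := by
    rw [inv_mul_lt_iff₀ (by positivity)]
    simpa using h2
  linarith

theorem aux_usc (u : ℂ → ℝ) (D : Set ℂ) (hu : UpperSemicontinuousOn u D)
    (F : ℂ → ℂ) (hF : Differentiable ℂ F) :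
    UpperSemicontinuousOn (fun z => u z - (F z).re) D := by
  have hc : Continuous (fun z => -(F z).re) := (Complex.continuous_re.comp hF.continuous).neg
  simpa [sub_eq_add_neg] using hu.add (hc.upperSemicontinuous.upperSemicontinuousOn D)

theorem aux_sphere (u : ℂ → ℝ) (D : Set ℂ) (a : ℝ) (hu : SubharmonicOn u D)
    (hb : ∀ z ∈ D, 0 ≤ u z ∧ u z < a) (F : ℂ → ℂ) (hF : Differentiable ℂ F)
    (c : ℂ) (ρ : ℝ) (hρ : 0 < ρ) (hsub : closedBall c ρ ⊆ D)
    (hmax : ∀ z ∈ sphere c ρ, u z - (F z).re ≤ u c - (F c).re) :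
    ∀ z ∈ sphere c ρ, u z - (F z).re = u c - (F c).re := by
  have hmem : ∀ t, circleMap c ρ t ∈ D := fun t => hsub (circleMap_mem_closedBall c hρ.le t)
  have hcm := continuous_circleMap c ρ
  have husc1 : UpperSemicontinuous (fun t => u (circleMap c ρ t)) := by
    rw [← upperSemicontinuousOn_univ_iff]
    exact hu.1.comp hcm.continuousOn (fun t _ => hmem t)
  have husc : UpperSemicontinuous
      (fun t => u (circleMap c ρ t) - (F (circleMap c ρ t)).re) := by
    rw [← upperSemicontinuousOn_univ_iff]
    exact (aux_usc u D hu.1 F hF).comp hcm.continuousOn (fun t _ => hmem t)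
  have hi1 : ∀ x y, IntervalIntegrable (fun t => u (circleMap c ρ t)) MeasureTheory.volume x y := by
    intro x y
    apply (intervalIntegrable_const (c := a)).mono_fun husc1.measurable.aestronglyMeasurable
    refine Eventually.of_forall fun t => ?_
    have := hb _ (hmem t)
    simp only [Real.norm_eq_abs]
    rw [abs_of_nonneg this.1]
    exact this.2.le.trans (le_abs_self a)
  have hFc : Continuous (fun t => F (circleMap c ρ t)) := hF.continuous.comp hcm
  have hi2 : ∀ x y, IntervalIntegrable (fun t => (F (circleMap c ρ t)).re)
      MeasureTheory.volume x y :=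
    fun x y => (Complex.continuous_re.comp hFc).intervalIntegrable x y
  have hmean : (2 * Real.pi)⁻¹ * ∫ t in (0:ℝ)..(2 * Real.pi), (F (circleMap c ρ t)).re
      = (F c).re := by
    have h1 : Real.circleAverage F c ρ = F c :=
      DiffContOnCl.circleAverage (hF.diffContOnCl)
    have h2 : ∫ t in (0:ℝ)..(2 * Real.pi), (F (circleMap c ρ t)).re
        = (∫ t in (0:ℝ)..(2 * Real.pi), F (circleMap c ρ t)).re := by
      have := Complex.reCLM.intervalIntegral_comp_comm
        (hFc.intervalIntegrable (μ := MeasureTheory.volume) 0 (2 * Real.pi))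
      simpa using this
    rw [h2, ← h1, Real.circleAverage_def, Complex.smul_re, smul_eq_mul]
  intro z hz
  rw [← abs_of_pos hρ, ← range_circleMap] at hz
  obtain ⟨t, rfl⟩ := hz
  apply aux_circle (fun t => u (circleMap c ρ t) - (F (circleMap c ρ t)).re) _ _ husc
    (fun x y => (hi1 x y).sub (hi2 x y))
    (fun t => hmax _ (circleMap_mem_sphere c hρ.le t))
  · rw [intervalIntegral.integral_sub (hi1 _ _) (hi2 _ _), mul_sub, hmean]
    linarith [hu.2 c ρ hρ hsub]
  · intro t
    simp [periodic_circleMap c ρ t]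

theorem aux_mp (u : ℂ → ℝ) (D : Set ℂ) (a : ℝ) (hu : SubharmonicOn u D)
    (hb : ∀ z ∈ D, 0 ≤ u z ∧ u z < a) (F : ℂ → ℂ) (hF : Differentiable ℂ F)
    (U : Set ℂ) (hU : IsOpen U) (hbd : Bornology.IsBounded U) (hUD : U ⊆ D)
    (hbdry : ∀ ζ ∈ closure U, ζ ∉ U → ∀ ε > 0,
      ∀ᶠ z in nhdsWithin ζ U, u z - (F z).re < ε) :
    ∀ z ∈ U, u z - (F z).re ≤ 0 := by
  classical
  intro p hp
  by_contra hpos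
  push Not at hpos
  set f : ℂ → ℝ := fun z => u z - (F z).re with hf
  set g : ℂ → ℝ := fun z => if z ∈ U then f z else 0 with hg
  have hfusc : UpperSemicontinuousOn f U := (aux_usc u D hu.1 F hF).mono hUD
  have hK : IsCompact (closure U) := hbd.isCompact_closure
  have hgusc : UpperSemicontinuousOn g (closure U) := by
    intro ζ hζ y hy
    by_cases h : ζ ∈ U
    · have h1 : f ζ < y := by simpa [hg, h] using hy
      have h2 := hfusc ζ h y h1
      rw [hU.nhdsWithin_eq h] at h2
      apply nhdsWithin_le_nhds
      filter_upwards [h2, hU.mem_nhds h] with z hz hzU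
      simpa [hg, hzU] using hz
    · have h1 : 0 < y := by simpa [hg, h] using hy
      have h2 := hbdry ζ hζ h y h1
      rw [eventually_nhdsWithin_iff] at h2
      apply nhdsWithin_le_nhds
      filter_upwards [h2] with z hz
      by_cases hzU : z ∈ U
      · simpa [hg, hzU] using hz hzU
      · simpa [hg, hzU] using h1
  obtain ⟨q, hq, hqmax⟩ := hgusc.exists_isMaxOn ⟨p, subset_closure hp⟩ hK
  have hT : IsCompact (closure U ∩ g ⁻¹' Ici (g q)) := hgusc.isCompact_inter_preimage_Ici hK _
  obtain ⟨s, ⟨hs, hsq⟩, hsmax⟩ := hT.exists_isMaxOn ⟨q, hq, le_refl (g q)⟩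
    (f := Complex.im) (Complex.continuous_im.continuousOn)
  have hgs : 0 < g s := by
    have h1 : g p ≤ g q := hqmax (subset_closure hp)
    have h2 : g p = f p := by simp [hg, hp]
    have h3 : g q ≤ g s := hsq
    have h4 : 0 < f p := hpos
    linarith
  have hsU : s ∈ U := by
    by_contra h
    simp [hg, h] at hgs
  obtain ⟨ρ, hρ, hball⟩ := Metric.nhds_basis_closedBall.mem_iff.1 (hU.mem_nhds hsU)
  have hgf : ∀ z ∈ U, g z = f z := fun z hz => by simp [hg, hz]
  have hsph := aux_sphere u D a hu hb F hF s ρ hρ (hball.trans hUD) (by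
    intro z hz
    have hzU := hball (sphere_subset_closedBall hz)
    have h1 : g z ≤ g q := hqmax (subset_closure hzU)
    have h3 : g q ≤ g s := hsq
    rw [hgf z hzU] at h1
    rw [hgf s hsU] at h3
    exact h1.trans h3)
  have hw : s + ρ * Complex.I ∈ sphere s ρ := by
    simp [hρ.le]
  have hwU := hball (sphere_subset_closedBall hw)
  have h5 : f (s + ρ * Complex.I) = f s := hsph _ hw
  have h6 : (s + ρ * Complex.I).im ≤ s.im := by
    apply hsmax
    refine ⟨subset_closure hwU, ?_⟩
    change g q ≤ g _
    rw [hgf _ hwU, h5, ← hgf s hsU]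
    exact hsq
  simp at h6
  linarith

theorem aux_strip_isOpen (r : ℝ) : IsOpen {z : ℂ | 0 < z.im ∧ z.im < r} :=
  (isOpen_lt continuous_const Complex.continuous_im).inter
    (isOpen_lt Complex.continuous_im continuous_const)

theorem aux_rect (x₀ R r : ℝ) :
    IsOpen {z : ℂ | (0 < z.im ∧ z.im < r) ∧ (x₀ - R < z.re ∧ z.re < x₀ + R)} ∧
    Bornology.IsBounded {z : ℂ | (0 < z.im ∧ z.im < r) ∧ (x₀ - R < z.re ∧ z.re < x₀ + R)} ∧
    ∀ ζ ∈ closure {z : ℂ | (0 < z.im ∧ z.im < r) ∧ (x₀ - R < z.re ∧ z.re < x₀ + R)},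
      (0 ≤ ζ.im ∧ ζ.im ≤ r) ∧ (x₀ - R ≤ ζ.re ∧ ζ.re ≤ x₀ + R) := by
  refine ⟨?_, ?_, ?_⟩
  · exact (aux_strip_isOpen r).inter ((isOpen_lt continuous_const Complex.continuous_re).inter
      (isOpen_lt Complex.continuous_re continuous_const))
  · have h := (Metric.isBounded_Icc (x₀ - R) (x₀ + R)).reProdIm (Metric.isBounded_Icc 0 r)
    refine h.subset ?_
    rintro z ⟨⟨h1, h2⟩, h3, h4⟩
    exact ⟨⟨h3.le, h4.le⟩, h1.le, h2.le⟩
  · have hcl : IsClosed {z : ℂ | (0 ≤ z.im ∧ z.im ≤ r) ∧ (x₀ - R ≤ z.re ∧ z.re ≤ x₀ + R)} :=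
      ((isClosed_le continuous_const Complex.continuous_im).inter
        (isClosed_le Complex.continuous_im continuous_const)).inter
      ((isClosed_le continuous_const Complex.continuous_re).inter
      (isClosed_le Complex.continuous_re continuous_const))
    intro ζ hζ
    refine hcl.closure_subset_iff.2 ?_ hζ
    rintro z ⟨⟨h1, h2⟩, h3, h4⟩
    exact ⟨⟨h1.le, h2.le⟩, h3.le, h4.le⟩

/-- boundary behaviour at interior points of `D`. -/
theorem aux_bdry_int (u : ℂ → ℝ) (D : Set ℂ) (hu : UpperSemicontinuousOn u D)
    (F : ℂ → ℂ) (hF : Differentiable ℂ F) (U : Set ℂ) (hUD : U ⊆ D) (ζ : ℂ) (hζ : ζ ∈ D)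
    (h0 : u ζ - (F ζ).re ≤ 0) (ε : ℝ) (hε : 0 < ε) :
    ∀ᶠ z in nhdsWithin ζ U, u z - (F z).re < ε :=
  nhdsWithin_mono ζ hUD (aux_usc u D hu F hF ζ hζ ε (by linarith))

/-- boundary behaviour at points with an upper limit. -/
theorem aux_bdry_lim (u : ℂ → ℝ) (D : Set ℂ)
    (F : ℂ → ℂ) (hF : Differentiable ℂ F) (U : Set ℂ) (hUD : U ⊆ D) (ζ : ℂ) (l : ℝ)
    (hl : ∀ δ > 0, ∀ᶠ z in nhdsWithin ζ D, u z < l + δ)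
    (h0 : l ≤ (F ζ).re) (ε : ℝ) (hε : 0 < ε) :
    ∀ᶠ z in nhdsWithin ζ U, u z - (F z).re < ε := by
  have hc : Continuous (fun z => (F z).re) := Complex.continuous_re.comp hF.continuous
  have h1 : ∀ᶠ z in nhds ζ, (F ζ).re - ε / 2 < (F z).re :=
    hc.continuousAt.eventually (lt_mem_nhds (by linarith))
  filter_upwards [nhdsWithin_mono ζ hUD (hl (ε / 2) (by linarith)), nhdsWithin_le_nhds h1]
    with z h2 h3
  linarith

theorem aux_real_lim (u : ℂ → ℝ) (D : Set ℂ)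
    (hboundary : ∀ x : ℝ, Tendsto u (nhdsWithin (x : ℂ) D) (nhds 0)) (ζ : ℂ) (hζ : ζ.im = 0) :
    ∀ δ > 0, ∀ᶠ z in nhdsWithin ζ D, u z < 0 + δ := by
  intro δ hδ
  have : ζ = (ζ.re : ℂ) := by apply Complex.ext <;> simp [hζ]
  rw [this]
  exact (hboundary ζ.re).eventually (gt_mem_nhds (by linarith))

theorem aux_le (r a : ℝ) (hr : 0 < r) (ha : 0 < a)
    (D : Set ℂ) (hD : D = {z : ℂ | 0 < z.im ∧ z.im < r})
    (u : ℂ → ℝ) (hu : SubharmonicOn u D)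
    (hbound : ∀ z ∈ D, 0 ≤ u z ∧ u z < a)
    (hboundary : ∀ x : ℝ, Tendsto u (nhdsWithin (x : ℂ) D) (nhds 0)) :
    ∀ z ∈ D, u z ≤ a / r * z.im := by
  intro z hz
  have key : ∀ ε > 0, u z ≤ a / r * z.im + ε * (z.re ^ 2 - z.im ^ 2 + r ^ 2) := by
    intro ε hε
    obtain ⟨R, hR0, hR1, hR2⟩ : ∃ R : ℝ, 0 < R ∧ |z.re| < R ∧ a ≤ ε * R ^ 2 := by
      refine ⟨|z.re| + 1 + a / ε, by positivity, by linarith [div_pos ha hε], ?_⟩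
      have h1 : 0 ≤ |z.re| := abs_nonneg _
      have h2 : 0 < a / ε := div_pos ha hε
      have h3 : ε * (a / ε) = a := by field_simp
      have h4 : a / ε ≤ (|z.re| + 1 + a / ε) ^ 2 := by nlinarith
      calc a = ε * (a / ε) := h3.symm
        _ ≤ _ := by gcongr
    set F : ℂ → ℂ := fun w => -(((a / r : ℝ) : ℂ) * (Complex.I * w))
      + (ε : ℂ) * (w ^ 2 + (r : ℂ) ^ 2) with hFdef
    have hF : Differentiable ℂ F := by fun_prop
    have hFre : ∀ w, (F w).re = a / r * w.im + ε * (w.re ^ 2 - w.im ^ 2 + r ^ 2) := by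
      intro w
      simp only [hFdef, pow_two, Complex.add_re, Complex.neg_re, Complex.I_re,
        Complex.I_im, Complex.mul_im, Complex.mul_re, Complex.ofReal_re, Complex.ofReal_im]
      ring
    obtain ⟨hUo, hUb, hUc⟩ := aux_rect 0 R r
    set U : Set ℂ := {z : ℂ | (0 < z.im ∧ z.im < r) ∧ (0 - R < z.re ∧ z.re < 0 + R)} with hUdef
    have hUD : U ⊆ D := by
      rw [hD]; exact fun w hw => hw.1
    have hmp := aux_mp u D a hu hbound F hF U hUo hUb hUD (by
      intro ζ hζ hζU ε' hε'
      obtain ⟨⟨h1, h2⟩, h3, h4⟩ := hUc ζ hζ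
      rcases h1.eq_or_lt with h1 | h1
      · apply aux_bdry_lim u D F hF U hUD ζ 0 (aux_real_lim u D hboundary ζ h1.symm) _ ε' hε'
        rw [hFre, ← h1]
        have : 0 ≤ ε * (ζ.re ^ 2 + r ^ 2) := by positivity
        linarith
      · rcases h2.eq_or_lt with h2 | h2
        · apply aux_bdry_lim u D F hF U hUD ζ a _ _ ε' hε'
          · intro δ hδ
            filter_upwards [self_mem_nhdsWithin] with w hw
            linarith [(hbound w hw).2]
          · rw [hFre, h2, div_mul_cancel₀ a hr.ne']
            have : 0 ≤ ε * (ζ.re ^ 2 - r ^ 2 + r ^ 2) := by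
              rw [sub_add_cancel]; positivity
            linarith
        · have hζD : ζ ∈ D := by rw [hD]; exact ⟨h1, h2⟩
          apply aux_bdry_int u D hu.1 F hF U hUD ζ hζD _ ε' hε'
          have hre : ζ.re ^ 2 = R ^ 2 := by
            by_contra hne
            apply hζU
            refine ⟨⟨h1, h2⟩, lt_of_le_of_ne h3 ?_, lt_of_le_of_ne h4 ?_⟩
            · intro h; apply hne; rw [← h]; ring
            · intro h; apply hne; rw [h]; ring
          rw [hFre, hre]
          have h5 := (hbound ζ hζD).2
          have h6 : 0 ≤ a / r * ζ.im := by positivity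
          have h7 : 0 ≤ ε * (r ^ 2 - ζ.im ^ 2) := mul_nonneg hε.le (by nlinarith)
          nlinarith)
    have hz' := hD ▸ hz
    have hzU : z ∈ U := ⟨hz', by linarith [(abs_lt.1 hR1).1], by linarith [(abs_lt.1 hR1).2]⟩
    have := hmp z hzU
    rw [hFre] at this
    linarith
  have hlim : Tendsto (fun ε : ℝ => a / r * z.im + ε * (z.re ^ 2 - z.im ^ 2 + r ^ 2))
      (nhdsWithin 0 (Ioi 0)) (nhds (a / r * z.im)) := by
    have : Continuous (fun ε : ℝ => a / r * z.im + ε * (z.re ^ 2 - z.im ^ 2 + r ^ 2)) := by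
      fun_prop
    have h := this.tendsto 0
    simp only [zero_mul, add_zero] at h
    exact h.mono_left nhdsWithin_le_nhds
  exact ge_of_tendsto hlim (by filter_upwards [self_mem_nhdsWithin] with ε hε using key ε hε)

theorem aux_case1 (r a : ℝ) (hr : 0 < r) (ha : 0 < a)
    (D : Set ℂ) (hD : D = {z : ℂ | 0 < z.im ∧ z.im < r})
    (u : ℂ → ℝ) (hu : SubharmonicOn u D)
    (hbound : ∀ z ∈ D, 0 ≤ u z ∧ u z < a)
    (hboundary : ∀ x : ℝ, Tendsto u (nhdsWithin (x : ℂ) D) (nhds 0))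
    (z₀ : ℂ) (hz₀ : z₀ ∈ D) (h0 : u z₀ = a / r * z₀.im) :
    ∀ z ∈ D, u z = a / r * z.im := by
  have hle := aux_le r a hr ha D hD u hu hbound hboundary
  have hDo : IsOpen D := by rw [hD]; exact aux_strip_isOpen r
  have hDp : IsPreconnected D := by
    have : Convex ℝ D := by
      rw [hD]
      exact (convex_halfSpace_im_gt 0).inter (convex_halfSpace_im_lt r)
    exact this.isPreconnected
  set F : ℂ → ℂ := fun w => -(((a / r : ℝ) : ℂ) * (Complex.I * w)) with hFdef
  have hF : Differentiable ℂ F := by fun_prop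
  have hFre : ∀ w, (F w).re = a / r * w.im := by
    intro w
    simp only [hFdef, Complex.neg_re, Complex.re_ofReal_mul, Complex.I_mul_re]
    ring
  have husc := aux_usc u D hu.1 F hF
  set Z : Set ℂ := {z | z ∈ D ∧ u z = a / r * z.im} with hZ
  have hZo : IsOpen Z := by
    rw [isOpen_iff_mem_nhds]
    rintro s ⟨hsD, hs⟩
    obtain ⟨ρ, hρ, hball⟩ := Metric.nhds_basis_closedBall.mem_iff.1 (hDo.mem_nhds hsD)
    filter_upwards [closedBall_mem_nhds s hρ] with w hw
    refine ⟨hball hw, ?_⟩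
    by_cases hws : w = s
    · rw [hws, hs]
    · have hd : 0 < dist w s := dist_pos.2 hws
      have hsub : closedBall s (dist w s) ⊆ D := (closedBall_subset_closedBall hw).trans hball
      have := aux_sphere u D a hu hbound F hF s (dist w s) hd hsub (by
        intro z hz
        have h1 := hle z (hsub (sphere_subset_closedBall hz))
        rw [hFre, hFre]; linarith) w (mem_sphere.2 rfl)
      rw [hFre, hFre] at this
      linarith
  have hsubset : D ⊆ Z := by
    apply hDp.subset_of_closure_inter_subset hZo ⟨z₀, hz₀, hz₀, h0⟩
    rintro w ⟨hwc, hwD⟩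
    refine ⟨hwD, le_antisymm (hle w hwD) ?_⟩
    by_contra hlt
    push Not at hlt
    have h1 := husc w hwD 0 (by change u w - (F w).re < 0; rw [hFre]; linarith)
    rw [hDo.nhdsWithin_eq hwD] at h1
    obtain ⟨z, hz1, hz2⟩ := mem_closure_iff_nhds.1 hwc _ h1
    have hz1' : u z - (F z).re < 0 := hz1
    rw [hFre, hz2.2] at hz1'
    linarith
  exact fun z hz => (hsubset hz).2

theorem aux_hopf (r a : ℝ) (hr : 0 < r) (ha : 0 < a)
    (D : Set ℂ) (hD : D = {z : ℂ | 0 < z.im ∧ z.im < r})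
    (u : ℂ → ℝ) (hu : SubharmonicOn u D)
    (hbound : ∀ z ∈ D, 0 ≤ u z ∧ u z < a)
    (hboundary : ∀ x : ℝ, Tendsto u (nhdsWithin (x : ℂ) D) (nhds 0))
    (hlt : ∀ z ∈ D, u z < a / r * z.im) (x₀ : ℝ) :
    ∃ δ > 0, ∀ y : ℝ, 0 < y → y < r / 2 →
      u ((x₀ : ℂ) + y * Complex.I) ≤ (a / r - δ) * y := by
  set F₀ : ℂ → ℂ := fun w => -(((a / r : ℝ) : ℂ) * (Complex.I * w)) with hF₀def
  have hF₀ : Differentiable ℂ F₀ := by fun_prop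
  have hF₀re : ∀ w, (F₀ w).re = a / r * w.im := by
    intro w
    simp only [hF₀def, Complex.neg_re, Complex.re_ofReal_mul, Complex.I_mul_re]
    ring
  set X : ℝ := 1 + r with hX
  have hX0 : 0 < X := by positivity
  set S : Set ℂ := Icc (x₀ - X) (x₀ + X) ×ℂ {r / 2} with hS
  have hSc : IsCompact S := isCompact_Icc.reProdIm isCompact_singleton
  have hSD : S ⊆ D := by
    rintro w ⟨_, hw⟩
    have hw' : w.im = r / 2 := hw
    rw [hD]
    constructor <;> (rw [hw']; linarith)
  have hSne : S.Nonempty := ⟨⟨x₀, r / 2⟩, ⟨by constructor <;> simp <;> linarith, rfl⟩⟩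
  obtain ⟨q, hqS, hqmax⟩ := ((aux_usc u D hu.1 F₀ hF₀).mono hSD).exists_isMaxOn hSne hSc
  obtain ⟨m, hm⟩ : ∃ m : ℝ, m = -(u q - (F₀ q).re) := ⟨_, rfl⟩
  have hm0 : 0 < m := by
    have := hlt q (hSD hqS)
    rw [hm, hF₀re]; linarith
  have hSm : ∀ w ∈ S, u w - a / r * w.im ≤ -m := by
    intro w hw
    have : u w - (F₀ w).re ≤ u q - (F₀ q).re := hqmax hw
    rw [hF₀re w] at this
    linarith
  obtain ⟨δ, hδ, hδm⟩ : ∃ δ : ℝ, 0 < δ ∧ δ * (r / 2 * (1 + r ^ 2)) = m :=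
    ⟨m / (r / 2 * (1 + r ^ 2)), by positivity, by field_simp⟩
  set F : ℂ → ℂ := fun w => -(((a / r : ℝ) : ℂ) * (Complex.I * w))
      + (δ : ℂ) * (Complex.I * ((w - x₀) - (w - x₀) * (w - x₀) * (w - x₀) / ((3 : ℝ) : ℂ)))
      with hFdef
  have hF : Differentiable ℂ F := by fun_prop
  have hFre : ∀ w, (F w).re = a / r * w.im
      - δ * (w.im * (1 - (w.re - x₀) ^ 2 + w.im ^ 2 / 3)) := by
    intro w
    simp only [hFdef, Complex.add_re, Complex.neg_re, Complex.re_ofReal_mul, Complex.I_re,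
      Complex.I_im, Complex.sub_im, Complex.div_ofReal_im, Complex.mul_im, Complex.mul_re, Complex.sub_re,
      Complex.ofReal_re, Complex.ofReal_im]
    ring
  obtain ⟨hUo, hUb, hUc⟩ := aux_rect x₀ X (r / 2)
  set U : Set ℂ := {z : ℂ | (0 < z.im ∧ z.im < r / 2) ∧ (x₀ - X < z.re ∧ z.re < x₀ + X)}
    with hUdef
  have hUD : U ⊆ D := by
    rw [hD]; exact fun w hw => ⟨hw.1.1, by linarith [hw.1.2]⟩
  have hmp := aux_mp u D a hu hbound F hF U hUo hUb hUD (by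
    intro ζ hζ hζU ε' hε'
    obtain ⟨⟨h1, h2⟩, h3, h4⟩ := hUc ζ hζ
    rcases h1.eq_or_lt with h1 | h1
    · apply aux_bdry_lim u D F hF U hUD ζ 0 (aux_real_lim u D hboundary ζ h1.symm) _ ε' hε'
      rw [hFre, ← h1]
      simp
    · have hζD : ζ ∈ D := by rw [hD]; exact ⟨h1, by linarith⟩
      apply aux_bdry_int u D hu.1 F hF U hUD ζ hζD _ ε' hε'
      rw [hFre]
      rcases h2.eq_or_lt with h2 | h2
      · have h5 := hSm ζ ⟨⟨h3, h4⟩, h2⟩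
        have h6 : δ * (ζ.im * (1 - (ζ.re - x₀) ^ 2 + ζ.im ^ 2 / 3)) ≤ m := by
          rw [← hδm, h2]
          have h7 : 1 - (ζ.re - x₀) ^ 2 + (r / 2) ^ 2 / 3 ≤ 1 + r ^ 2 := by
            nlinarith [sq_nonneg (ζ.re - x₀), sq_nonneg r]
          exact mul_le_mul_of_nonneg_left
            (mul_le_mul_of_nonneg_left h7 (by linarith)) hδ.le
        linarith
      · have hre : (ζ.re - x₀) ^ 2 = X ^ 2 := by
          by_contra hne
          apply hζU
          refine ⟨⟨h1, h2⟩, lt_of_le_of_ne h3 ?_, lt_of_le_of_ne h4 ?_⟩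
          · intro h; apply hne; rw [← h]; ring
          · intro h; apply hne; rw [h]; ring
        have h5 := hlt ζ hζD
        have h6 : ζ.im * (1 - X ^ 2 + ζ.im ^ 2 / 3) ≤ 0 := by
          apply mul_nonpos_of_nonneg_of_nonpos h1.le
          rw [hX]
          nlinarith
        rw [hre]
        nlinarith)
  refine ⟨δ, hδ, fun y hy0 hy1 => ?_⟩
  have hre : ((x₀ : ℂ) + y * Complex.I).re = x₀ := by simp
  have him : ((x₀ : ℂ) + y * Complex.I).im = y := by simp
  have := hmp ((x₀ : ℂ) + y * Complex.I)
    ⟨⟨by rw [him]; exact hy0, by rw [him]; exact hy1⟩,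
      by rw [hre]; linarith, by rw [hre]; linarith⟩
  rw [hFre, hre, him] at this
  have h7 : 0 ≤ δ * (y * (y ^ 2 / 3)) := by positivity
  nlinarith

/-- **Schwarz lemma for the strip, equality case** (Theorem 2.2, second part).
With `D = {0 < Im z < r}` and `u : D → [0, a)` subharmonic vanishing at the real
boundary: if either `u z₀ = (a/r) · Im z₀` at some point `z₀ ∈ D`, or
`limsup_{y → 0⁺} u (x₀ + iy)/y = a/r` for some real `x₀`, then `u z = (a/r) · Im z`
for every `z ∈ D`. -/
theorem subharmonic_strip_schwarz_eq (r a : ℝ) (hr : 0 < r) (ha : 0 < a)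
    (D : Set ℂ) (hD : D = {z : ℂ | 0 < z.im ∧ z.im < r})
    (u : ℂ → ℝ) (hu : SubharmonicOn u D)
    (hbound : ∀ z ∈ D, 0 ≤ u z ∧ u z < a)
    (hboundary : ∀ x : ℝ, Tendsto u (nhdsWithin (x : ℂ) D) (nhds 0))
    (hcase :
      (∃ z₀ ∈ D, u z₀ = a / r * z₀.im) ∨
        ∃ x₀ : ℝ, limsup (fun y : ℝ => u ((x₀ : ℂ) + y * Complex.I) / y)
          (nhdsWithin 0 (Set.Ioi 0)) = a / r) :
    ∀ z ∈ D, u z = a / r * z.im := by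
  rcases hcase with ⟨z₀, hz₀, h0⟩ | ⟨x₀, hx₀⟩
  · exact aux_case1 r a hr ha D hD u hu hbound hboundary z₀ hz₀ h0
  · by_contra hcon
    have hlt : ∀ z ∈ D, u z < a / r * z.im := by
      intro z hz
      refine lt_of_le_of_ne (aux_le r a hr ha D hD u hu hbound hboundary z hz) fun h => hcon ?_
      exact aux_case1 r a hr ha D hD u hu hbound hboundary z hz h
    obtain ⟨δ, hδ, hmain⟩ := aux_hopf r a hr ha D hD u hu hbound hboundary hlt x₀
    have hev : ∀ᶠ y : ℝ in nhdsWithin 0 (Set.Ioi 0), 0 < y ∧ y < r / 2 :=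
      Ioo_mem_nhdsGT (by linarith)
    have hlow : ∀ᶠ y : ℝ in nhdsWithin 0 (Set.Ioi 0),
        0 ≤ u ((x₀ : ℂ) + y * Complex.I) / y := by
      filter_upwards [hev] with y hy
      refine div_nonneg (hbound _ ?_).1 hy.1.le
      rw [hD]
      constructor
      · simpa using hy.1
      · have : y < r := by linarith [hy.2]
        simpa using this
    have hco : (nhdsWithin (0:ℝ) (Set.Ioi 0)).IsCoboundedUnder (· ≤ ·)
        (fun y : ℝ => u ((x₀ : ℂ) + y * Complex.I) / y) :=
      IsBoundedUnder.isCoboundedUnder_le ⟨0, by simpa using hlow⟩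
    have : limsup (fun y : ℝ => u ((x₀ : ℂ) + y * Complex.I) / y)
          (nhdsWithin 0 (Set.Ioi 0)) ≤ a / r - δ := by
      apply limsup_le_of_le hco
      filter_upwards [hev] with y hy
      rw [div_le_iff₀ hy.1]
      exact hmain y hy.1 hy.2
    linarith
end

section
/- Let Δ be the open unit disc in ℂ and I = (−1,1). Then for every x ∈ I and every ξ ∈ ℝ = T_xI one has E_{I,Δ}(x,ξ) = |ξ|/(1−x²); that is, the pseudo-metric E_{I,Δ} on the center I is the restriction of the Poincaré metric of Δ. -/
open Metric Filter Complex Set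

/-- The class `𝒰(I, Δ)` for the analytic pair `(I, Δ)`, `I = (-1, 1)` and `Δ` the unit
disc: subharmonic functions `u : Δ → [0, π/4)` vanishing on `I`. -/
def MemPSHU (u : ℂ → ℝ) : Prop :=
  SubharmonicOn u (ball (0 : ℂ) 1) ∧
    (∀ z ∈ ball (0 : ℂ) 1, 0 ≤ u z ∧ u z < Real.pi / 4) ∧
    ∀ x : ℝ, x ∈ Set.Ioo (-1 : ℝ) 1 → u (x : ℂ) = 0

/-- `E_{u,Δ}(x, ξ)`: the infimum over all `C¹` curves `γ : (-ε, ε) → Δ` with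
`γ 0 = x` and `γ' 0 = i·ξ` of `limsup_{t→0⁺} u (γ t) / t` (computed in `EReal`). -/
noncomputable def EInf (u : ℂ → ℝ) (x : ℂ) (ξ : ℝ) : EReal :=
  sInf {L : EReal | ∃ ε : ℝ, 0 < ε ∧ ∃ γ : ℝ → ℂ,
    ContDiffOn ℝ 1 γ (Set.Ioo (-ε) ε) ∧ (∀ t ∈ Set.Ioo (-ε) ε, γ t ∈ ball (0 : ℂ) 1) ∧
    γ 0 = x ∧ HasDerivAt γ (Complex.I * (ξ : ℂ)) 0 ∧
    L = limsup (fun t : ℝ => ((u (γ t) / t : ℝ) : EReal)) (nhdsWithin 0 (Set.Ioi 0))}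

/-- `E_{I,Δ}(x, ξ) = sup_{u ∈ 𝒰(I,Δ)} E_{u,Δ}(x, ξ)`. -/
noncomputable def ESup (x : ℂ) (ξ : ℝ) : EReal :=
  ⨆ u ∈ {u : ℂ → ℝ | MemPSHU u}, EInf u x ξ


/-- The Cayley transform. -/
noncomputable def cay (z : ℂ) : ℂ := (1 + z) / (1 - z)

/-- The harmonic function of the problem. -/
noncomputable def hh (z : ℂ) : ℝ := (cay z).arg / 2

lemma cay_re (z : ℂ) : (cay z).re = (1 - normSq z) / normSq (1 - z) := by
  unfold cay
  rw [Complex.div_re, ← add_div]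
  congr 1
  simp [normSq_apply]; ring

lemma cay_im (z : ℂ) : (cay z).im = 2 * z.im / normSq (1 - z) := by
  unfold cay
  rw [Complex.div_im, ← sub_div]
  congr 1
  simp; ring

lemma normSq_lt {z : ℂ} (hz : ‖z‖ < 1) : normSq z < 1 := by
  rw [normSq_eq_norm_sq]; nlinarith [norm_nonneg z]

lemma normSq_one_sub_pos {z : ℂ} (hz : z ≠ 1) : 0 < normSq (1 - z) := by
  rw [normSq_pos, sub_ne_zero]; exact hz.symm

lemma ne_one_of {z : ℂ} (hz : ‖z‖ < 1) : z ≠ 1 := by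
  rintro rfl; simp at hz

lemma cay_re_pos {z : ℂ} (hz : ‖z‖ < 1) : 0 < (cay z).re := by
  rw [cay_re]
  exact div_pos (by linarith [normSq_lt hz]) (normSq_one_sub_pos (ne_one_of hz))

lemma cay_slit {z : ℂ} (hz : ‖z‖ < 1) : cay z ∈ slitPlane := Or.inl (cay_re_pos hz)

lemma cay_hasDerivAt {z : ℂ} (hz : z ≠ 1) : HasDerivAt cay (2 / (1 - z) ^ 2) z := by
  have h1 : (1 : ℂ) - z ≠ 0 := sub_ne_zero.2 hz.symm
  have := ((hasDerivAt_id z).const_add 1).div ((hasDerivAt_id z).const_sub 1) h1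
  refine this.congr_deriv ?_
  simp only [id]
  field_simp
  ring

lemma hh_eq (z : ℂ) : hh z = (-(I / 2) * log (cay z)).re := by
  unfold hh
  simp [log_im]; ring

lemma logcay_hasDerivAt {z : ℂ} (hz : ‖z‖ < 1) :
    HasDerivAt (fun z => -(I / 2) * log (cay z)) (-I / (1 - z ^ 2)) z := by
  have h1 : (1 : ℂ) - z ≠ 0 := sub_ne_zero.2 (ne_one_of hz).symm
  have h2 : (1 : ℂ) + z ≠ 0 := by
    intro h
    have : z = -1 := by linear_combination h
    rw [this] at hz; simp at hz
  have h3 : (1 : ℂ) - z ^ 2 ≠ 0 := by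
    have : (1 : ℂ) - z ^ 2 = (1 - z) * (1 + z) := by ring
    rw [this]; exact mul_ne_zero h1 h2
  refine (((cay_hasDerivAt (ne_one_of hz)).clog (cay_slit hz)).const_mul (-(I / 2))).congr_deriv ?_
  unfold cay
  have : (1 : ℂ) - z ^ 2 = (1 - z) * (1 + z) := by ring
  rw [this]
  field_simp

lemma hh_contAt {z : ℂ} (hz1 : z ≠ 1) (hs : cay z ∈ slitPlane) : ContinuousAt hh z := by
  unfold hh
  exact ((continuousAt_arg hs).comp (cay_hasDerivAt hz1).continuousAt).div_const 2

lemma avg_re {G : ℂ → ℂ} {c : ℂ} {r : ℝ} (hr : 0 < r)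
    (hG : ∀ z ∈ closedBall c r, DifferentiableAt ℂ G z) :
    CircleIntegrable (fun z => (G z).re) c r ∧
      (2 * Real.pi)⁻¹ * ∫ θ in (0:ℝ)..(2 * Real.pi), (G (circleMap c r θ)).re = (G c).re := by
  have hc : ContinuousOn G (closedBall c r) := fun z hz => (hG z hz).continuousAt.continuousWithinAt
  have hci : ContinuousOn (fun z => (G z).re) (sphere c r) :=
    continuous_re.comp_continuousOn (hc.mono sphere_subset_closedBall)
  refine ⟨hci.circleIntegrable hr.le, ?_⟩
  have h1 : Real.circleAverage G c r = G c := by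
    apply circleAverage_of_differentiable_on_off_countable countable_empty
    · rwa [abs_of_pos hr]
    · intro z hz
      rw [abs_of_pos hr] at hz
      exact hG z (ball_subset_closedBall hz.1)
  have h2 := reCLM.circleAverage_comp_comm
    ((hc.mono sphere_subset_closedBall).circleIntegrable hr.le)
  rw [h1] at h2
  simpa [Real.circleAverage_def, Function.comp_def] using h2

lemma abs_hh_mem : MemPSHU (fun z => |hh z|) := by
  have hcont : ∀ z ∈ ball (0 : ℂ) 1, ContinuousAt hh z := by
    intro z hz
    rw [mem_ball_zero_iff] at hz
    exact hh_contAt (ne_one_of hz) (cay_slit hz)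
  refine ⟨⟨?_, ?_⟩, ?_, ?_⟩
  · apply ContinuousOn.upperSemicontinuousOn
    intro z hz
    exact (hcont z hz).abs.continuousWithinAt
  · intro c r hr hsub
    have h := avg_re (G := fun z => -(I / 2) * log (cay z)) hr (fun z hz =>
      (logcay_hasDerivAt (mem_ball_zero_iff.1 (hsub hz))).differentiableAt)
    simp only [← hh_eq] at h
    show |hh c| ≤ (2 * Real.pi)⁻¹ * ∫ θ in (0:ℝ)..(2 * Real.pi), |hh (circleMap c r θ)|
    rw [← h.2, abs_mul, abs_of_pos (by positivity)]
    gcongr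
    exact intervalIntegral.abs_integral_le_integral_abs (by positivity)
  · intro z hz
    rw [mem_ball_zero_iff] at hz
    refine ⟨abs_nonneg _, ?_⟩
    have := abs_arg_lt_pi_div_two_iff.2 (Or.inl (cay_re_pos hz))
    show |(cay z).arg / 2| < Real.pi / 4
    rw [abs_div, abs_two]; linarith
  · intro x hx
    have : ‖(x : ℂ)‖ < 1 := by
      rw [norm_real, Real.norm_eq_abs, abs_lt]; exact hx
    have h0 : (cay x).arg = 0 := by
      rw [arg_eq_zero_iff]
      exact ⟨(cay_re_pos this).le, by rw [cay_im]; simp⟩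
    simp [hh, h0]

lemma key_r {u : ℂ → ℝ} (hu : MemPSHU u) {r : ℝ} (hr0 : 0 < r) (hr1 : r < 1) {ε : ℝ} (hε : 0 < ε)
    {z : ℂ} (hz : z ∈ closedBall (0 : ℂ) r) :
    u z - |hh (z / r)| + ε * (normSq z - 1) ≤ 0 := by
  obtain ⟨⟨husc, hsub⟩, hbd, hI⟩ := hu
  have hKs : closedBall (0 : ℂ) r ⊆ ball 0 1 := closedBall_subset_ball hr1
  have hrc : (r : ℂ) ≠ 0 := by exact_mod_cast hr0.ne'
  set w : ℂ → ℝ := fun z => u z - |hh (z / r)| + ε * (normSq z - 1) with hw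
  -- points of the closed ball off the two corners
  have hslit : ∀ y ∈ closedBall (0 : ℂ) r, y ≠ r → y ≠ -r →
      y / r ≠ 1 ∧ cay (y / r) ∈ slitPlane := by
    intro y hy h1 h2
    have h3 : y / r ≠ 1 := by
      rwa [Ne, div_eq_one_iff_eq hrc]
    refine ⟨h3, ?_⟩
    rw [mem_closedBall_zero_iff] at hy
    have hn : ‖y / r‖ ≤ 1 := by
      rw [norm_div, norm_real, Real.norm_eq_abs, abs_of_pos hr0]
      exact (div_le_one hr0).2 hy
    rcases hn.lt_or_eq with h | h
    · exact cay_slit h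
    · right
      rw [cay_im]
      apply div_ne_zero _ (normSq_one_sub_pos h3).ne'
      intro him
      have him : (y / r).im = 0 := by linarith
      have hre : (y / r).re ^ 2 = 1 := by
        have := normSq_eq_norm_sq (y / r)
        rw [h, normSq_apply, him] at this
        linarith
      rcases mul_self_eq_one_iff.1 ((sq _).symm.trans hre) with h' | h'
      · exact h3 (Complex.ext (by simpa using h') (by simpa using him))
      · apply h2
        have : y / r = -1 := Complex.ext (by simpa using h') (by simpa using him)
        rw [div_eq_iff hrc] at this
        simpa using this
  have hcorner : ∀ y : ℂ, y = r ∨ y = -r → hh (y / r) = 0 := by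
    rintro y (rfl | rfl)
    · simp [hh, cay, hrc]
    · simp [hh, cay, hrc]
  have hwusc : UpperSemicontinuousOn w (closedBall (0 : ℂ) r) := by
    have hnc : Continuous (fun z : ℂ => ε * (normSq z - 1)) := by fun_prop
    have hu1 : UpperSemicontinuousOn (fun z => u z + ε * (normSq z - 1)) (closedBall (0 : ℂ) r) :=
      (husc.mono hKs).add (hnc.upperSemicontinuous.upperSemicontinuousOn _)
    intro y hy
    by_cases hc : y = r ∨ y = -r
    · intro a ha
      simp only [hw, hcorner y hc, abs_zero, sub_zero] at ha
      filter_upwards [hu1 y hy a ha] with v hv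
      simp only [hw]
      linarith [abs_nonneg (hh (v / r))]
    · push Not at hc
      have h := hslit y hy hc.1 hc.2
      have hca : ContinuousAt (fun z : ℂ => -|hh (z / r)|) y :=
        (ContinuousAt.comp (f := fun z : ℂ => z / r) (g := hh) (hh_contAt h.1 h.2)
          (by fun_prop)).abs.neg
      have := UpperSemicontinuousWithinAt.add (hu1 y hy) hca.continuousWithinAt.upperSemicontinuousWithinAt
      have he : w = (fun z => (u z + ε * (normSq z - 1)) + -|hh (z / r)|) := by
        funext v; simp only [hw]; ring
      rw [he]
      exact this
  obtain ⟨c, hcK, hmax⟩ := hwusc.exists_isMaxOn ⟨z, hz⟩ (isCompact_closedBall _ _)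
  have hmax : ∀ y ∈ closedBall (0 : ℂ) r, w y ≤ w c := fun y hy => hmax hy
  refine (hmax z hz).trans ?_
  by_contra! hpos
  have hnc : normSq c < 1 := normSq_lt (mem_ball_zero_iff.1 (hKs hcK))
  have hlt : 0 < u c - |hh (c / r)| := by
    have : ε * (normSq c - 1) < 0 := mul_neg_of_pos_of_neg hε (by linarith)
    simp only [hw] at hpos; linarith
  -- c is not real
  have him : c.im ≠ 0 := by
    intro him
    have hc : c = (c.re : ℂ) := Complex.ext (by simp) (by simpa using him)
    have h1 := hKs hcK
    rw [hc, mem_ball_zero_iff, norm_real, Real.norm_eq_abs, abs_lt] at h1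
    have := hI c.re h1
    rw [← hc] at this
    linarith [abs_nonneg (hh (c / r))]
  have hne1 : c ≠ r := by rintro rfl; simp at him
  have hne2 : c ≠ -r := by rintro rfl; simp at him
  have hsl := hslit c hcK hne1 hne2
  have himr : (c / r).im ≠ 0 := by
    rw [div_ofReal_im]; exact div_ne_zero him hr0.ne'
  have hcim : (cay (c / r)).im ≠ 0 := by
    rw [cay_im]
    exact div_ne_zero (by simpa using himr) (normSq_one_sub_pos hsl.1).ne'
  -- c is not on the boundary
  have hcin : ‖c‖ < r := by
    refine lt_of_le_of_ne (mem_closedBall_zero_iff.1 hcK) fun hcr => ?_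
    have hn : normSq (c / r) = 1 := by
      rw [normSq_eq_norm_sq, norm_div, norm_real, Real.norm_eq_abs, abs_of_pos hr0, hcr,
        div_self hr0.ne']; norm_num
    have hre : (cay (c / r)).re = 0 := by rw [cay_re, hn]; simp
    have h4 : Real.pi / 2 ≤ |(cay (c / r)).arg| := by
      by_contra! h
      rcases abs_arg_lt_pi_div_two_iff.1 h with h | h
      · linarith
      · rw [h] at hcim; simp at hcim
    have h5 : Real.pi / 4 ≤ |hh (c / r)| := by
      unfold hh; rw [abs_div, abs_two]; linarith
    linarith [(hbd c (hKs hcK)).2]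
  have hhne : hh (c / r) ≠ 0 := by
    unfold hh
    intro h
    have h : (cay (c / r)).arg = 0 := by linarith
    exact hcim (arg_eq_zero_iff.1 h).2
  have hca : ContinuousAt (fun z : ℂ => hh (z / r)) c :=
    (ContinuousAt.comp (f := fun z : ℂ => z / r) (g := hh) (hh_contAt hsl.1 hsl.2) (by fun_prop))
  obtain ⟨s, hs, hsc⟩ : ∃ s : ℝ, |hh (c / r)| = s * hh (c / r) ∧
      ∀ᶠ y in nhds c, |hh (y / r)| = s * hh (y / r) := by
    rcases lt_or_gt_of_ne hhne with h | h
    · refine ⟨-1, by rw [abs_of_neg h]; ring, ?_⟩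
      filter_upwards [hca.eventually (gt_mem_nhds h)] with y hy
      rw [abs_of_neg hy]; ring
    · refine ⟨1, by rw [abs_of_pos h]; ring, ?_⟩
      filter_upwards [hca.eventually (lt_mem_nhds h)] with y hy
      rw [abs_of_pos hy]; ring
  have hin : ∀ᶠ y in nhds c, y ∈ ball (0 : ℂ) r :=
    isOpen_ball.mem_nhds (mem_ball_zero_iff.2 hcin)
  obtain ⟨ρ, hρ, hρs⟩ := Metric.nhds_basis_closedBall.eventually_iff.1 (hsc.and hin)
  set G : ℂ → ℂ := fun y => (w c + ε - ε * (normSq c + ρ ^ 2) : ℝ)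
    - 2 * ε * (starRingEnd ℂ c) * (y - c) + s * (-(I / 2) * log (cay (y / r))) with hG
  have hGd : ∀ y ∈ closedBall c ρ, DifferentiableAt ℂ G y := by
    intro y hy
    have h1 := (hρs hy).2
    have h2 : ‖y / r‖ < 1 := by
      rw [norm_div, norm_real, Real.norm_eq_abs, abs_of_pos hr0, div_lt_one hr0]
      exact mem_ball_zero_iff.1 h1
    have h3 : DifferentiableAt ℂ (fun y : ℂ => -(I / 2) * log (cay (y / r))) y :=
      DifferentiableAt.comp (g := fun z => -(I / 2) * log (cay z)) (f := fun y : ℂ => y / r) y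
        (logcay_hasDerivAt h2).differentiableAt (by fun_prop)
    simp only [hG]
    exact DifferentiableAt.add (by fun_prop) (h3.const_mul _)
  have hGre : ∀ y, (G y).re = w c + ε - ε * (normSq c + ρ ^ 2)
      - 2 * ε * (c.re * (y - c).re + c.im * (y - c).im) + s * hh (y / r) := by
    intro y
    rw [hh_eq, hG]
    simp only [add_re, sub_re, re_ofReal_mul, ofReal_re]
    congr 2
    simp [mul_re, mul_im]; ring
  obtain ⟨hGi, hGa⟩ := avg_re hρ hGd
  have hule : ∀ θ : ℝ, u (circleMap c ρ θ) ≤ (G (circleMap c ρ θ)).re ∧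
      0 ≤ u (circleMap c ρ θ) := by
    intro θ
    set y := circleMap c ρ θ with hy
    have hyb : y ∈ closedBall c ρ := circleMap_mem_closedBall c hρ.le θ
    have h1 := hρs hyb
    have hyK := ball_subset_closedBall h1.2
    refine ⟨?_, (hbd y (hKs hyK)).1⟩
    have h2 := hmax y hyK
    have h3 : w y = u y - s * hh (y / r) + ε * (normSq y - 1) := by
      simp only [hw]; rw [h1.1]
    have h4 : (y - c).re ^ 2 + (y - c).im ^ 2 = ρ ^ 2 := by
      have : ‖y - c‖ = ρ := by
        have := circleMap_mem_sphere c hρ.le θ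
        rwa [← hy, mem_sphere_iff_norm] at this
      rw [← this, ← normSq_eq_norm_sq, normSq_apply]; ring
    rw [hGre, ← h4]
    rw [h3] at h2
    rw [normSq_apply] at h2 ⊢
    simp only [sub_re, sub_im]
    linarith
  have h6 := hsub c ρ hρ (fun y hy => hKs (ball_subset_closedBall (hρs hy).2))
  have h7 : (∫ θ in (0:ℝ)..(2 * Real.pi), u (circleMap c ρ θ)) ≤
      ∫ θ in (0:ℝ)..(2 * Real.pi), (G (circleMap c ρ θ)).re := by
    rw [intervalIntegral.integral_of_le (by positivity),
      intervalIntegral.integral_of_le (by positivity)]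
    apply MeasureTheory.integral_mono_of_nonneg
    · exact Eventually.of_forall fun θ => (hule θ).2
    · exact (intervalIntegrable_iff_integrableOn_Ioc_of_le (by positivity)).1 hGi
    · exact Eventually.of_forall fun θ => (hule θ).1
  have h8 : u c ≤ (G c).re := by
    rw [← hGa]
    refine h6.trans ?_
    gcongr
  rw [hGre] at h8
  simp only [sub_self, zero_re, zero_im, mul_zero, add_zero, sub_zero] at h8
  have h9 : w c = u c - s * hh (c / r) + ε * (normSq c - 1) := by
    simp only [hw]; rw [hs]
  have h10 : 0 < ε * ρ ^ 2 := by positivity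
  rw [h9] at h8
  nlinarith

lemma key {u : ℂ → ℝ} (hu : MemPSHU u) {z : ℂ} (hz : z ∈ ball (0 : ℂ) 1) : u z ≤ |hh z| := by
  rw [mem_ball_zero_iff] at hz
  have h1 : ∀ r : ℝ, r ∈ Ioo (‖z‖) 1 → u z ≤ |hh (z / r)| := by
    intro r hr
    have hr0 : 0 < r := (norm_nonneg z).trans_lt hr.1
    apply le_of_forall_pos_le_add
    intro ε hε
    have := key_r hu hr0 hr.2 hε (mem_closedBall_zero_iff.2 hr.1.le)
    nlinarith [normSq_nonneg z]
  have hc : ContinuousAt (fun r : ℝ => |hh (z / r)|) 1 := by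
    refine ContinuousAt.abs (ContinuousAt.comp (f := fun r : ℝ => z / r) (g := hh) ?_ ?_)
    · have : z / ((1 : ℝ) : ℂ) = z := by simp
      rw [this]
      exact hh_contAt (ne_one_of hz) (cay_slit hz)
    · exact ContinuousAt.div continuousAt_const continuous_ofReal.continuousAt (by simp)
  have ht : Tendsto (fun r : ℝ => |hh (z / r)|) (nhdsWithin 1 (Iio 1)) (nhds |hh z|) := by
    have := hc.tendsto.mono_left (nhdsWithin_le_nhds (s := Iio 1))
    simpa using this
  refine ge_of_tendsto ht ?_
  filter_upwards [Ioo_mem_nhdsLT hz] with r hr using h1 r hr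

lemma limsup_hh {x : ℝ} (hx : x ∈ Set.Ioo (-1 : ℝ) 1) {ξ : ℝ} {γ : ℝ → ℂ} (h0 : γ 0 = x)
    (hd : HasDerivAt γ (I * (ξ : ℂ)) 0) :
    limsup (fun t : ℝ => ((|hh (γ t)| / t : ℝ) : EReal)) (nhdsWithin 0 (Set.Ioi 0)) =
      ((|ξ| / (1 - x ^ 2) : ℝ) : EReal) := by
  have hxn : ‖(x : ℂ)‖ < 1 := by
    rw [norm_real, Real.norm_eq_abs, abs_lt]; exact hx
  have hpos : 0 < 1 - x ^ 2 := by nlinarith [hx.1, hx.2]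
  have h1 : HasDerivAt (fun t => -(I / 2) * log (cay (γ t))) (-I / (1 - (x : ℂ) ^ 2) * (I * ξ)) 0 := by
    have h := logcay_hasDerivAt hxn
    rw [← h0] at h ⊢
    exact HasDerivAt.comp (h₂ := fun z => -(I / 2) * log (cay z)) 0 h hd
  have h2 : HasDerivAt (fun t => hh (γ t)) (ξ / (1 - x ^ 2)) 0 := by
    have h3 := (reCLM.hasFDerivAt.comp_hasDerivAt (0 : ℝ) h1)
    have h4 : (-I / (1 - (x : ℂ) ^ 2) * (I * ξ)) = ((ξ / (1 - x ^ 2) : ℝ) : ℂ) := by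
      have : (1 - (x : ℂ) ^ 2) ≠ 0 := by exact_mod_cast hpos.ne'
      push_cast
      field_simp
      rw [I_sq]; ring
    rw [h4] at h3
    simp only [hh_eq]
    exact h3
  have hz : hh (γ 0) = 0 := by
    rw [h0]
    simpa using abs_hh_mem.2.2 x hx
  have h5 := h2.tendsto_slope_zero_right.abs
  have h6 : Tendsto (fun t : ℝ => |hh (γ t)| / t) (nhdsWithin 0 (Set.Ioi 0))
      (nhds (|ξ| / (1 - x ^ 2))) := by
    rw [abs_div, abs_of_pos hpos] at h5
    refine h5.congr' ?_
    filter_upwards [self_mem_nhdsWithin] with t ht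
    have ht : 0 < t := ht
    simp only [hz, zero_add, sub_zero, smul_eq_mul, abs_mul, abs_inv, abs_of_pos ht]
    rw [inv_mul_eq_div]
  exact ((continuous_coe_real_ereal.tendsto _).comp h6).limsup_eq

/-- **Theorem 3.3** (metric part).  For the unit disc `Δ` with center `I = (-1, 1)` one
has `E_{I,Δ}(x, ξ) = |ξ| / (1 - x²)`, i.e. the pseudo-metric `E_{I,Δ}` on the center is
the restriction of the Poincaré metric of `Δ`. -/
theorem disc_E_metric (x : ℝ) (hx : x ∈ Set.Ioo (-1 : ℝ) 1) (ξ : ℝ) :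
    ESup (x : ℂ) ξ = ((|ξ| / (1 - x ^ 2) : ℝ) : EReal) := by
  have hxn : (x : ℂ) ∈ ball (0 : ℂ) 1 := by
    rw [mem_ball_zero_iff, norm_real, Real.norm_eq_abs, abs_lt]; exact hx
  apply le_antisymm
  · refine iSup₂_le fun u hu => ?_
    have hu : MemPSHU u := hu
    set γ : ℝ → ℂ := fun t => x + t * (I * ξ) with hγ
    have hγ0 : γ 0 = x := by simp [hγ]
    have hγd : HasDerivAt γ (I * (ξ : ℂ)) 0 := by
      have := ((ofRealCLM.hasDerivAt (x := (0 : ℝ))).mul_const (I * (ξ : ℂ))).const_add (x : ℂ)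
      simpa [hγ] using this
    have hγc : ContDiff ℝ 1 γ := by
      have : ContDiff ℝ 1 (fun t : ℝ => (t : ℂ)) := ofRealCLM.contDiff
      exact contDiff_const.add (this.mul contDiff_const)
    have hin : ∀ᶠ t in nhds (0 : ℝ), γ t ∈ ball (0 : ℂ) 1 := by
      apply hγc.continuous.continuousAt.eventually_mem
      rw [hγ0]
      exact isOpen_ball.mem_nhds hxn
    obtain ⟨ε, hε, hεs⟩ := Metric.eventually_nhds_iff_ball.1 hin
    have hmem : ∀ t ∈ Set.Ioo (-ε) ε, γ t ∈ ball (0 : ℂ) 1 := by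
      intro t ht
      apply hεs
      rw [mem_ball_zero_iff, Real.norm_eq_abs, abs_lt]; exact ht
    rw [← limsup_hh hx hγ0 hγd]
    refine le_trans (b := limsup (fun t : ℝ => ((u (γ t) / t : ℝ) : EReal)) (nhdsWithin 0 (Set.Ioi 0)))
      (sInf_le ⟨ε, hε, γ, hγc.contDiffOn, hmem, hγ0, hγd, rfl⟩) ?_
    refine limsup_le_limsup ?_
    filter_upwards [Ioo_mem_nhdsGT hε] with t ht
    have h1 := key hu (hmem t ⟨by linarith [ht.1], ht.2⟩)
    have ht0 : 0 < t := ht.1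
    rw [EReal.coe_le_coe_iff]
    gcongr
  · refine le_iSup₂_of_le (fun z => |hh z|) abs_hh_mem ?_
    refine le_sInf ?_
    rintro L ⟨ε, hε, γ, -, -, h0, hd, rfl⟩
    exact (limsup_hh hx h0 hd).ge
end
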